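/- arXiv:2109.06886 — 8 statements merged into one kernel-verified Lean document; each statement's English description precedes it below -/
import Mathlib

section
/- Let x1, x2, x3, x4, x5, x6 be real numbers satisfying x1 > 0, x2 > 0, 4·x2·x6 > x3², and (4·x2·x6 − x3²)·x5 > x6·x4². Then x5 > 0, x6 > 0, and x5·(x6 + 36·x2 − 6·x3) − 9·x4² > 0. In particular, x6·x5·(x6 + 36·x2 − 6·x3) − 9·x6·x4² > x5·(3·x3 − x6)² ≥ 0. -/
/-- If the couplings `(x1,…,x6)` lie in the positivity domain `𝒟` (i.e. `x1 > 0`, `x2 > 0`,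
`4·x2·x6 > x3²`, `(4·x2·x6 − x3²)·x5 > x6·x4²`), then `x5 > 0`, `x6 > 0`, the denominator
`x5·(x6 + 36·x2 − 6·x3) − 9·x4²` of the bound constant is positive, and moreover
`x6·x5·(x6 + 36·x2 − 6·x3) − 9·x6·x4² > x5·(3·x3 − x6)² ≥ 0`. -/
theorem domain_denominator_pos (x1 x2 x3 x4 x5 x6 : ℝ)
    (h1 : 0 < x1) (h2 : 0 < x2)
    (h3 : x3 ^ 2 < 4 * x2 * x6)
    (h4 : x6 * x4 ^ 2 < (4 * x2 * x6 - x3 ^ 2) * x5) :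
    0 < x5 ∧ 0 < x6 ∧ 0 < x5 * (x6 + 36 * x2 - 6 * x3) - 9 * x4 ^ 2 ∧
      x5 * (3 * x3 - x6) ^ 2 < x6 * x5 * (x6 + 36 * x2 - 6 * x3) - 9 * x6 * x4 ^ 2 ∧
      0 ≤ x5 * (3 * x3 - x6) ^ 2 := by
  have hx6 : 0 < x6 :=
    pos_of_mul_pos_right ((sq_nonneg x3).trans_lt h3) (by positivity)
  have hx5 : 0 < x5 :=
    pos_of_mul_pos_right ((by positivity : 0 ≤ x6 * x4 ^ 2).trans_lt h4) (sub_pos.2 h3).le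
  have hsq : 0 ≤ x5 * (3 * x3 - x6) ^ 2 := by positivity
  have hlt : x5 * (3 * x3 - x6) ^ 2 <
      x6 * x5 * (x6 + 36 * x2 - 6 * x3) - 9 * x6 * x4 ^ 2 := by
    linarith
  refine ⟨hx5, hx6, pos_of_mul_pos_right (a := x6) ?_ hx6.le, hlt, hsq⟩
  linarith
end

section
/- Let x1, ..., x6 be real numbers satisfying x1 > 0, x2 > 0, 4·x2·x6 > x3², and (4·x2·x6 − x3²)·x5 > x6·x4². Set C_max = 3·√( x1·((4·x2·x6 − x3²)·x5 − x6·x4²) / (x5·(x6 + 36·x2 − 6·x3) − 9·x4²) ). Then for all (x,y,u,v) ∈ ℝ⁴, Ω_E(x,y,u,v) ≥ C_max·|Ω_Q(x,y,u,v)|, where Ω_E(x,y,u,v) = x1·x² + x2·y² + (x6/4)·u² + (x5/4)·v² − (x3/2)·u·y − (x4/2)·v·y and Ω_Q(x,y,u,v) = x·u − (1/3)·x·y. -/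
/-- Cauchy–Schwarz for the binary form `a y² - 2 e u y + b u²` against the functional `3u - y`. -/
lemma det_mul_sq_le_binary_form (a b e y u : ℝ) :
    (a * b - e ^ 2) * (3 * u - y) ^ 2 ≤
      (b + 9 * a - 6 * e) * (a * y ^ 2 + b * u ^ 2 - 2 * e * u * y) := by
  nlinarith [sq_nonneg ((3 * a - e) * y + (b - 3 * e) * u)]

/-- If `c² w² ≤ 4 a q`, then the quadratic form `a x² + q` dominates `c |x w|`. -/
lemma mul_abs_mul_le_of_sq_mul_sq_le {a c q w : ℝ} (x : ℝ) (ha : 0 < a)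
    (h : c ^ 2 * w ^ 2 ≤ 4 * a * q) : c * |x * w| ≤ a * x ^ 2 + q := by
  have hx := sq_abs x
  have hw := sq_abs w
  rw [abs_mul]
  have h4 : 0 ≤ 4 * a * (a * x ^ 2 + q - c * (|x| * |w|)) := by
    rw [← hx]
    rw [← hw] at h
    nlinarith [sq_nonneg (2 * a * |x| - c * |w|)]
  linarith [nonneg_of_mul_nonneg_right h4 (by positivity)]

/-- Topological energy bound (Theorem 1, pointwise quadratic-form version): for couplings in the
domain `𝒟`, the energy form `Ω_E` dominates `C_max` times the absolute value of the charge form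
`Ω_Q`, where `C_max = 3·√(x1·((4·x2·x6 − x3²)·x5 − x6·x4²)/(x5·(x6 + 36·x2 − 6·x3) − 9·x4²))`. -/
theorem omegaE_ge_Cmax_abs_omegaQ (x1 x2 x3 x4 x5 x6 C_max : ℝ)
    (h1 : 0 < x1) (h2 : 0 < x2)
    (h3 : x3 ^ 2 < 4 * x2 * x6)
    (h4 : x6 * x4 ^ 2 < (4 * x2 * x6 - x3 ^ 2) * x5)
    (hC : C_max = 3 * Real.sqrt
      (x1 * ((4 * x2 * x6 - x3 ^ 2) * x5 - x6 * x4 ^ 2) /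
        (x5 * (x6 + 36 * x2 - 6 * x3) - 9 * x4 ^ 2))) :
    ∀ x y u v : ℝ,
      x1 * x ^ 2 + x2 * y ^ 2 + (x6 / 4) * u ^ 2 + (x5 / 4) * v ^ 2
        - (x3 / 2) * u * y - (x4 / 2) * v * y ≥
      C_max * |x * u - (1 / 3) * x * y| := by
  intro x y u v
  set N := (4 * x2 * x6 - x3 ^ 2) * x5 - x6 * x4 ^ 2 with hN
  set D := x5 * (x6 + 36 * x2 - 6 * x3) - 9 * x4 ^ 2 with hD
  have N_pos : 0 < N := sub_pos.mpr h4
  have hx6 : 0 < x6 := by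
    have : 0 < 4 * x2 * x6 := (sq_nonneg x3).trans_lt h3
    exact pos_of_mul_pos_right this (by positivity)
  have hx5 : 0 < x5 := by
    have : 0 < (4 * x2 * x6 - x3 ^ 2) * x5 := lt_of_le_of_lt (by positivity) h4
    exact pos_of_mul_pos_right this (sub_pos.mpr h3).le
  have A_pos : 0 < 4 * x2 * x5 - x4 ^ 2 := by
    have : 0 < x6 * (4 * x2 * x5 - x4 ^ 2) := by
      have : x6 * (4 * x2 * x5 - x4 ^ 2) = N + x3 ^ 2 * x5 := by rw [hN]; ring
      rw [this]; positivity
    exact pos_of_mul_pos_right this hx6.le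
  have D_pos : 0 < D := by
    have : 0 < (4 * x2 * x5 - x4 ^ 2) * D := by
      have : (4 * x2 * x5 - x4 ^ 2) * D =
          (3 * (4 * x2 * x5 - x4 ^ 2) - x3 * x5) ^ 2 + x5 * N := by rw [hN, hD]; ring
      rw [this]; positivity
    exact pos_of_mul_pos_right this A_pos.le
  set q := x2 * y ^ 2 + (x6 / 4) * u ^ 2 + (x5 / 4) * v ^ 2
    - (x3 / 2) * u * y - (x4 / 2) * v * y with hq
  have key : N * (3 * u - y) ^ 2 ≤ 4 * q * D := by
    refine le_of_mul_le_mul_left ?_ hx5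
    have hform := det_mul_sq_le_binary_form (4 * x2 * x5 - x4 ^ 2) (x5 * x6) (x3 * x5) y u
    have hv : 0 ≤ D * (x5 * v - x4 * y) ^ 2 := by positivity
    rw [hN, hq, hD]
    rw [hD] at hv
    linarith
  have hsq : C_max ^ 2 * (u - y / 3) ^ 2 ≤ 4 * x1 * q := by
    rw [hC, mul_pow, Real.sq_sqrt (by positivity)]
    calc 3 ^ 2 * (x1 * N / D) * (u - y / 3) ^ 2
        = x1 * (N * (3 * u - y) ^ 2 / D) := by ring
      _ ≤ x1 * (4 * q) := by gcongr; exact (div_le_iff₀ D_pos).mpr key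
      _ = 4 * x1 * q := by ring
  have hmain := mul_abs_mul_le_of_sq_mul_sq_le x h1 hsq
  rw [show x * u - 1 / 3 * x * y = x * (u - y / 3) by ring]
  linarith
end

section
/- Let x1, ..., x6 be real numbers satisfying x1 > 0, x2 > 0, 4·x2·x6 > x3², and (4·x2·x6 − x3²)·x5 > x6·x4², and set C_max = 3·√( x1·((4·x2·x6 − x3²)·x5 − x6·x4²) / (x5·(x6 + 36·x2 − 6·x3) − 9·x4²) ). Then for every real C with C > C_max, the quadratic form Ω_E − C·Ω_Q is not positive semidefinite; that is, there exists (x,y,u,v) ∈ ℝ⁴ with Ω_E(x,y,u,v) < C·Ω_Q(x,y,u,v). -/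
/-- Sharpness of the bound constant: for couplings in the domain `𝒟` and any `C > C_max`, the
quadratic form `Ω_E − C·Ω_Q` fails to be positive semidefinite, i.e. there is a point of `ℝ⁴`
where `Ω_E < C·Ω_Q`. -/
theorem omegaE_sub_C_omegaQ_not_posSemidef (x1 x2 x3 x4 x5 x6 C_max : ℝ)
    (h1 : 0 < x1) (h2 : 0 < x2)
    (h3 : x3 ^ 2 < 4 * x2 * x6)
    (h4 : x6 * x4 ^ 2 < (4 * x2 * x6 - x3 ^ 2) * x5)
    (hC : C_max = 3 * Real.sqrt
      (x1 * ((4 * x2 * x6 - x3 ^ 2) * x5 - x6 * x4 ^ 2) /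
        (x5 * (x6 + 36 * x2 - 6 * x3) - 9 * x4 ^ 2))) :
    ∀ C : ℝ, C_max < C →
      ∃ x y u v : ℝ,
        x1 * x ^ 2 + x2 * y ^ 2 + (x6 / 4) * u ^ 2 + (x5 / 4) * v ^ 2
          - (x3 / 2) * u * y - (x4 / 2) * v * y <
        C * (x * u - (1 / 3) * x * y) := by
  have hx6 : 0 < x6 := by
    by_contra! h
    nlinarith [sq_nonneg x3, mul_nonneg h2.le (neg_nonneg.2 h)]
  have hx5 : 0 < x5 :=
    pos_of_mul_pos_right ((mul_nonneg hx6.le (sq_nonneg x4)).trans_lt h4) (sub_pos.2 h3).le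
  set N := (4 * x2 * x6 - x3 ^ 2) * x5 - x6 * x4 ^ 2 with hN
  set K := x5 * (x6 + 36 * x2 - 6 * x3) - 9 * x4 ^ 2 with hK
  have hNpos : 0 < N := sub_pos.2 h4
  have hKpos : 0 < K := by
    have h : x6 * K = x5 * (x6 - 3 * x3) ^ 2 + 9 * N := by rw [hN, hK]; ring
    refine pos_of_mul_pos_right (a := x6) ?_ hx6.le
    rw [h]
    positivity
  intro C hlt
  have hsq : 9 * (x1 * N) < C ^ 2 * K := by
    have hroot : √(x1 * N / K) < C / 3 := by linarith
    have hCpos : 0 < C / 3 := (Real.sqrt_nonneg _).trans_lt hroot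
    have h := (div_lt_iff₀ hKpos).1 ((Real.sqrt_lt' hCpos).1 hroot)
    linarith
  -- This point minimizes `Ω_E - C * Ω_Q` on the hyperplane `u - y / 3 = K / 3`.
  refine ⟨C * K / (6 * x1), x5 * (3 * x3 - x6), 3 * (4 * x2 * x5 - x4 ^ 2) - x3 * x5,
    x4 * (3 * x3 - x6), ?_⟩
  rw [← sub_pos]
  have hval : 0 < K * (C ^ 2 * K - 9 * (x1 * N)) / (36 * x1) := by
    have := sub_pos.2 hsq
    positivity
  convert hval using 1
  rw [hN, hK]
  field_simp
  ring
end

section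
/- Let x1, x3, x4, x5 be real numbers with x1 > 0, x3 > 0, and x5 > 0, and set x6 = 3·x3 and x2 = x3/12 + x4²/(4·x5). Then for all (x,y,u,v) ∈ ℝ⁴, Ω_E(x,y,u,v) ≥ √(3·x1·x3)·|Ω_Q(x,y,u,v)|, where Ω_E(x,y,u,v) = x1·x² + x2·y² + (x6/4)·u² + (x5/4)·v² − (x3/2)·u·y − (x4/2)·v·y and Ω_Q(x,y,u,v) = x·u − (1/3)·x·y. -/
/-- Weighted AM-GM inequality for the squares `p * x ^ 2` and `q * w ^ 2 / 4`. -/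
theorem sqrt_mul_abs_mul_le {p q : ℝ} (hp : 0 ≤ p) (hq : 0 ≤ q) (x w : ℝ) :
    Real.sqrt (p * q) * |x * w| ≤ p * x ^ 2 + q * w ^ 2 / 4 := by
  have key := sq_nonneg (Real.sqrt p * |x| - Real.sqrt q * |w| / 2)
  rw [sub_sq, div_pow, mul_pow, mul_pow, Real.sq_sqrt hp, Real.sq_sqrt hq, sq_abs, sq_abs] at key
  rw [Real.sqrt_mul hp, abs_mul]
  linarith

/-- Restricted topological energy bound (Theorem 2, pointwise quadratic-form version): on the
boundary component `x6 = 3·x3 > 0`, `x2 = x3/12 + x4²/(4·x5)` with `x1, x5 > 0`, the energy form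
satisfies `Ω_E ≥ √(3·x1·x3)·|Ω_Q|`. -/
theorem omegaE_ge_sqrt_abs_omegaQ_on_boundary (x1 x3 x4 x5 : ℝ)
    (h1 : 0 < x1) (h3 : 0 < x3) (h5 : 0 < x5)
    (x2 x6 : ℝ) (hx6 : x6 = 3 * x3) (hx2 : x2 = x3 / 12 + x4 ^ 2 / (4 * x5)) :
    ∀ x y u v : ℝ,
      x1 * x ^ 2 + x2 * y ^ 2 + (x6 / 4) * u ^ 2 + (x5 / 4) * v ^ 2
        - (x3 / 2) * u * y - (x4 / 2) * v * y ≥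
      Real.sqrt (3 * x1 * x3) * |x * u - (1 / 3) * x * y| := by
  intro x y u v
  subst hx6 hx2
  have energy_eq : x1 * x ^ 2 + (x3 / 12 + x4 ^ 2 / (4 * x5)) * y ^ 2 + (3 * x3 / 4) * u ^ 2
        + (x5 / 4) * v ^ 2 - (x3 / 2) * u * y - (x4 / 2) * v * y
      = x1 * x ^ 2 + 3 * x3 * (u - y / 3) ^ 2 / 4 + x5 / 4 * (v - x4 / x5 * y) ^ 2 := by
    field_simp
    ring
  have charge_eq : x * u - (1 / 3) * x * y = x * (u - y / 3) := by ring
  have hv : 0 ≤ x5 / 4 * (v - x4 / x5 * y) ^ 2 := by positivity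
  rw [energy_eq, charge_eq]
  rw [show 3 * x1 * x3 = x1 * (3 * x3) by ring]
  linarith [sqrt_mul_abs_mul_le h1.le (by positivity : 0 ≤ 3 * x3) x (u - y / 3)]
end

section
/- Let β > 0 and let φ : [−β/2, β/2] → ℝ be continuously differentiable, not constant, with φ(−t) = 1 − φ(t) for all t ∈ [−β/2, β/2]. Define x1 = ∫_{−β/2}^{β/2} (φ'(t))² dt, x2 = ∫_{−β/2}^{β/2} (1−φ)²·φ² dt, x3 = 2·∫_{−β/2}^{β/2} φ·(1−φ) dt, x4 = 2·∫_{−β/2}^{β/2} φ·(1−φ)·(1−2φ) dt, x5 = β − 2·x3, x6 = β. Then x4 = 0, x1 > 0, x2 > 0, 4·x2·x6 > x3², and (4·x2·x6 − x3²)·x5 > x6·x4². -/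
/-- The square of a continuous function that is somewhere nonzero has positive integral. -/
theorem integral_sq_pos_of_ne_zero {a b : ℝ} (hab : a < b) {f : ℝ → ℝ}
    (hf : ContinuousOn f (Set.Icc a b)) (hne : ∃ c ∈ Set.Icc a b, f c ≠ 0) :
    0 < ∫ t in a..b, f t ^ 2 := by
  obtain ⟨c, hc, hfc⟩ := hne
  exact intervalIntegral.integral_pos hab (hf.pow 2) (fun _ _ => sq_nonneg _)
    ⟨c, hc, by positivity⟩

/-- Strict Cauchy–Schwarz inequality against the constant function `1`: a continuous nonconstant
function has positive variance. -/
theorem sq_integral_lt_mul_integral_sq {a b : ℝ} (hab : a < b) {f : ℝ → ℝ}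
    (hf : ContinuousOn f (Set.Icc a b))
    (hnc : ∃ s ∈ Set.Icc a b, ∃ t ∈ Set.Icc a b, f s ≠ f t) :
    (∫ t in a..b, f t) ^ 2 < (b - a) * ∫ t in a..b, f t ^ 2 := by
  obtain ⟨s, hs, t, ht, hst⟩ := hnc
  have hba : 0 < b - a := sub_pos.2 hab
  set I := ∫ t in a..b, f t with hI
  have hpos : 0 < ∫ t in a..b, ((b - a) * f t - I) ^ 2 := by
    refine integral_sq_pos_of_ne_zero hab ((continuousOn_const.mul hf).sub continuousOn_const) ?_
    by_contra! h
    exact hst (mul_left_cancel₀ hba.ne' (by linarith [h s hs, h t ht]))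
  have hf1 : IntervalIntegrable f MeasureTheory.volume a b :=
    hf.intervalIntegrable_of_Icc hab.le
  have hf2 : IntervalIntegrable (fun t => f t ^ 2) MeasureTheory.volume a b :=
    (hf.pow 2).intervalIntegrable_of_Icc hab.le
  have hexp : ∫ t in a..b, ((b - a) * f t - I) ^ 2
      = (b - a) * ((b - a) * (∫ t in a..b, f t ^ 2) - I ^ 2) := by
    have hpt : ∀ t, ((b - a) * f t - I) ^ 2
        = ((b - a) ^ 2 * f t ^ 2 - 2 * (b - a) * I * f t) + I ^ 2 := fun t => by ring
    simp only [hpt]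
    rw [intervalIntegral.integral_add ((hf2.const_mul _).sub (hf1.const_mul _))
        intervalIntegrable_const,
      intervalIntegral.integral_sub (hf2.const_mul _) (hf1.const_mul _),
      intervalIntegral.integral_const_mul, intervalIntegral.integral_const_mul,
      intervalIntegral.integral_const, ← hI, smul_eq_mul]
    ring
  rw [hexp] at hpos
  linarith [pos_of_mul_pos_right hpos hba.le]

/-- An odd function on `[-a, a]` integrates to zero. -/
theorem integral_eq_zero_of_odd_on {a : ℝ} (ha : 0 ≤ a) {f : ℝ → ℝ}
    (hf : ∀ t ∈ Set.Icc (-a) a, f (-t) = -f t) : ∫ t in (-a)..a, f t = 0 := by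
  have h : ∫ t in (-a)..a, f (-t) = ∫ t in (-a)..a, -f t :=
    intervalIntegral.integral_congr fun t ht => hf t (by rwa [Set.uIcc_of_le (by linarith)] at ht)
  rw [intervalIntegral.integral_comp_neg, neg_neg, intervalIntegral.integral_neg] at h
  linarith

/-- For any nonconstant continuously differentiable kink function `φ` on `[−β/2, β/2]`
satisfying the parity condition `φ(−t) = 1 − φ(t)`, the Yang–Mills-derived couplings
`x1, …, x6` satisfy `x4 = 0` together with the four inequalities defining the positivity
domain `𝒟`. -/
theorem YM_couplings_in_domain (β : ℝ) (hβ : 0 < β) (φ φ' : ℝ → ℝ)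
    (hderiv : ∀ t ∈ Set.Icc (-β / 2) (β / 2), HasDerivAt φ (φ' t) t)
    (hcont : ContinuousOn φ' (Set.Icc (-β / 2) (β / 2)))
    (hnc : ¬ ∃ c : ℝ, ∀ t ∈ Set.Icc (-β / 2) (β / 2), φ t = c)
    (hpar : ∀ t ∈ Set.Icc (-β / 2) (β / 2), φ (-t) = 1 - φ t)
    (x1 x2 x3 x4 x5 x6 : ℝ)
    (hx1 : x1 = ∫ t in (-β / 2)..(β / 2), (φ' t) ^ 2)
    (hx2 : x2 = ∫ t in (-β / 2)..(β / 2), (1 - φ t) ^ 2 * (φ t) ^ 2)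
    (hx3 : x3 = 2 * ∫ t in (-β / 2)..(β / 2), φ t * (1 - φ t))
    (hx4 : x4 = 2 * ∫ t in (-β / 2)..(β / 2), φ t * (1 - φ t) * (1 - 2 * φ t))
    (hx5 : x5 = β - 2 * x3) (hx6 : x6 = β) :
    x4 = 0 ∧ 0 < x1 ∧ 0 < x2 ∧ x3 ^ 2 < 4 * x2 * x6 ∧
      x6 * x4 ^ 2 < (4 * x2 * x6 - x3 ^ 2) * x5 := by
  have hneg : -β / 2 = -(β / 2) := by ring
  have hab : -β / 2 < β / 2 := by linarith
  have hφ : ContinuousOn φ (Set.Icc (-β / 2) (β / 2)) :=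
    fun t ht => (hderiv t ht).continuousAt.continuousWithinAt
  have h0mem : (0 : ℝ) ∈ Set.Icc (-β / 2) (β / 2) := ⟨by linarith, by linarith⟩
  have h0 : φ 0 = 1 / 2 := by
    have h := hpar 0 h0mem
    rw [neg_zero] at h
    linarith
  obtain ⟨s, hs, hφs⟩ : ∃ s ∈ Set.Icc (-β / 2) (β / 2), 1 - 2 * φ s ≠ 0 := by
    by_contra! h
    exact hnc ⟨1 / 2, fun t ht => by linarith [h t ht]⟩
  have hf : ContinuousOn (fun t => φ t * (1 - φ t)) (Set.Icc (-β / 2) (β / 2)) :=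
    hφ.mul (continuousOn_const.sub hφ)
  have h4 : x4 = 0 := by
    rw [hx4, hneg, integral_eq_zero_of_odd_on (by linarith), mul_zero]
    intro t ht
    rw [hpar t (by rwa [hneg])]
    ring
  have h1 : 0 < x1 := by
    rw [hx1]
    refine integral_sq_pos_of_ne_zero hab hcont ?_
    by_contra! h
    refine hnc ⟨_, constant_of_has_deriv_right_zero hφ fun t ht => ?_⟩
    have ht' := Set.Ico_subset_Icc_self ht
    rw [← h t ht']
    exact (hderiv t ht').hasDerivWithinAt
  have hx2' : x2 = ∫ t in (-β / 2)..(β / 2), (φ t * (1 - φ t)) ^ 2 := by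
    rw [hx2]
    congr 1 with t
    ring
  have h2 : 0 < x2 := by
    rw [hx2']
    exact integral_sq_pos_of_ne_zero hab hf ⟨0, h0mem, by norm_num [h0]⟩
  have h3 : x3 ^ 2 < 4 * x2 * x6 := by
    have h := sq_integral_lt_mul_integral_sq hab hf ⟨0, h0mem, s, hs, fun h => hφs ?_⟩
    · rw [← hx2'] at h
      rw [hx3, hx6]
      linarith
    · simp only [h0] at h
      exact pow_eq_zero_iff two_ne_zero |>.1 (by linarith : (1 - 2 * φ s) ^ 2 = 0)
  have h5 : 0 < x5 := by
    have h : 0 < ∫ t in (-β / 2)..(β / 2), (1 - 2 * φ t) ^ 2 :=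
      integral_sq_pos_of_ne_zero hab (continuousOn_const.sub (continuousOn_const.mul hφ))
        ⟨s, hs, hφs⟩
    have hpt : ∀ t, (1 - 2 * φ t) ^ 2 = 1 - 4 * (φ t * (1 - φ t)) := fun t => by ring
    simp only [hpt] at h
    rw [intervalIntegral.integral_sub intervalIntegrable_const
        ((hf.intervalIntegrable_of_Icc hab.le).const_mul 4),
      intervalIntegral.integral_const_mul, intervalIntegral.integral_const, smul_eq_mul] at h
    rw [hx5, hx3]
    linarith
  refine ⟨h4, h1, h2, h3, ?_⟩
  rw [h4, zero_pow two_ne_zero, mul_zero]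
  exact mul_pos (sub_pos.2 h3) h5
end

section
/- Let φ(t) = sin(3πt/2 − π/4) on [−1/2, 1/2], and define x2 = ∫_{−1/2}^{1/2} (1−φ)²·φ² dt, x3 = 2·∫_{−1/2}^{1/2} φ·(1−φ) dt, and x4 = 2·∫_{−1/2}^{1/2} φ·(1−φ)·(1−2φ) dt. Then (4·x2 − x3²)·(1 − 2·x3) − x4² = −(768 + 2048π + 1512π² + 243π³)/(162π³); in particular this quantity is negative. -/
open Real

/-- Moments of the kink reduce to integrals of powers of `sin` over `[-π, π/2]`. -/
theorem integral_sine_kink_pow (n : ℕ) :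
    ∫ t in (-(1:ℝ) / 2)..(1 / 2), sin (3 * π * t / 2 - π / 4) ^ n =
      2 / (3 * π) * ∫ θ in (-π)..(π / 2), sin θ ^ n := by
  have hc : 3 * π / 2 ≠ 0 := by positivity
  have h := intervalIntegral.integral_comp_mul_sub (a := -(1:ℝ) / 2) (b := 1 / 2)
    (fun θ => sin θ ^ n) hc (π / 4)
  have ha : 3 * π / 2 * (-(1:ℝ) / 2) - π / 4 = -π := by ring
  have hb : 3 * π / 2 * (1 / 2) - π / 4 = π / 2 := by ring
  rw [ha, hb, smul_eq_mul, inv_div] at h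
  rw [← h]
  congr 1 with t
  ring_nf

theorem integral_sine_kink :
    ∫ t in (-(1:ℝ) / 2)..(1 / 2), sin (3 * π * t / 2 - π / 4) = -2 / (3 * π) := by
  have h := integral_sine_kink_pow 1
  simp only [pow_one, integral_sin, cos_neg, cos_pi, cos_pi_div_two] at h
  rw [h]
  ring

theorem integral_sine_kink_sq :
    ∫ t in (-(1:ℝ) / 2)..(1 / 2), sin (3 * π * t / 2 - π / 4) ^ 2 = 1 / 2 := by
  rw [integral_sine_kink_pow, integral_sin_sq]
  simp only [sin_neg, sin_pi, cos_pi_div_two]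
  field_simp
  ring

theorem integral_sine_kink_cube :
    ∫ t in (-(1:ℝ) / 2)..(1 / 2), sin (3 * π * t / 2 - π / 4) ^ 3 = -4 / (9 * π) := by
  rw [integral_sine_kink_pow, integral_sin_pow 1]
  simp only [pow_one, integral_sin, sin_neg, sin_pi, cos_neg, cos_pi, cos_pi_div_two]
  field_simp
  norm_num

theorem integral_sine_kink_pow_four :
    ∫ t in (-(1:ℝ) / 2)..(1 / 2), sin (3 * π * t / 2 - π / 4) ^ 4 = 3 / 8 := by
  rw [integral_sine_kink_pow, integral_sin_pow 2, integral_sin_sq]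
  simp only [sin_neg, sin_pi, cos_pi_div_two]
  field_simp
  norm_num
  ring

/-- The integral of a quartic polynomial in the kink with vanishing constant term. -/
theorem integral_sine_kink_quartic (a b c d : ℝ) :
    ∫ t in (-(1:ℝ) / 2)..(1 / 2),
      (a * sin (3 * π * t / 2 - π / 4) + b * sin (3 * π * t / 2 - π / 4) ^ 2 +
        c * sin (3 * π * t / 2 - π / 4) ^ 3 + d * sin (3 * π * t / 2 - π / 4) ^ 4) =
      a * (-2 / (3 * π)) + b * (1 / 2) + c * (-4 / (9 * π)) + d * (3 / 8) := by
  rw [intervalIntegral.integral_add, intervalIntegral.integral_add, intervalIntegral.integral_add]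
  · simp only [intervalIntegral.integral_const_mul, integral_sine_kink, integral_sine_kink_sq,
      integral_sine_kink_cube, integral_sine_kink_pow_four]
  all_goals exact Continuous.intervalIntegrable (by fun_prop) _ _

/-- For the non-monotone kink `φ(t) = sin(3πt/2 − π/4)` on `[−1/2, 1/2]`, the combination
`(4·x2 − x3²)·(1 − 2·x3) − x4²` of the derived couplings equals
`−(768 + 2048π + 1512π² + 243π³)/(162π³)`, which is negative; hence the positivity condition
fails for this kink. -/
theorem sine_kink_positivity_fails (φ : ℝ → ℝ)
    (hφ : ∀ t : ℝ, φ t = Real.sin (3 * Real.pi * t / 2 - Real.pi / 4))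
    (x2 x3 x4 : ℝ)
    (hx2 : x2 = ∫ t in (-(1:ℝ) / 2)..(1 / 2), (1 - φ t) ^ 2 * (φ t) ^ 2)
    (hx3 : x3 = 2 * ∫ t in (-(1:ℝ) / 2)..(1 / 2), φ t * (1 - φ t))
    (hx4 : x4 = 2 * ∫ t in (-(1:ℝ) / 2)..(1 / 2), φ t * (1 - φ t) * (1 - 2 * φ t)) :
    (4 * x2 - x3 ^ 2) * (1 - 2 * x3) - x4 ^ 2 =
      -(768 + 2048 * Real.pi + 1512 * Real.pi ^ 2 + 243 * Real.pi ^ 3)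
        / (162 * Real.pi ^ 3) ∧
    (4 * x2 - x3 ^ 2) * (1 - 2 * x3) - x4 ^ 2 < 0 := by
  have h2 : x2 = 7 / 8 + 8 / (9 * π) := by
    have h := integral_sine_kink_quartic 0 1 (-2) 1
    simp only [← hφ] at h
    calc x2 = _ := hx2
      _ = _ := by congr 1 with t; ring
      _ = _ := h
      _ = _ := by ring
  have h3 : x3 = -1 - 4 / (3 * π) := by
    have h := integral_sine_kink_quartic 1 (-1) 0 0
    simp only [← hφ] at h
    calc x3 = _ := hx3
      _ = 2 * _ := by congr 2 with t; ring
      _ = _ := congrArg (2 * ·) h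
      _ = _ := by ring
  have h4 : x4 = -3 - 28 / (9 * π) := by
    have h := integral_sine_kink_quartic 1 (-3) 2 0
    simp only [← hφ] at h
    calc x4 = _ := hx4
      _ = 2 * _ := by congr 2 with t; ring
      _ = _ := congrArg (2 * ·) h
      _ = _ := by ring
  have key : (4 * x2 - x3 ^ 2) * (1 - 2 * x3) - x4 ^ 2 =
      -(768 + 2048 * π + 1512 * π ^ 2 + 243 * π ^ 3) / (162 * π ^ 3) := by
    rw [h2, h3, h4]
    field_simp
    ring
  refine ⟨key, ?_⟩
  rw [key, neg_div, neg_lt_zero]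
  positivity
end

section
/- Let ε0, ε2, ε3 be positive real numbers with ε0·ε2 > ε3². Then for all real x3, √(ε2)·|1 − 3·x3| + 3·√(ε2·x3² + 4·ε3·x3 + 4·ε0) ≥ √(ε2 + 12·ε3 + 36·ε0), with equality if and only if x3 = 1/3. (Note that ε2·x3² + 4·ε3·x3 + 4·ε0 > 0 for all x3, since its discriminant 16·(ε3² − ε0·ε2) is negative.) -/
/-- Away from `x = 1/3`, the function with a kink at `1/3` strictly exceeds its value there. -/
lemma sqrt_lt_kink_of_ne {a b c x : ℝ} (ha : 0 < a) (hdisc : c ^ 2 < b * a) (hx : x ≠ 1 / 3) :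
    Real.sqrt (a + 12 * c + 36 * b) <
      Real.sqrt a * |1 - 3 * x| + 3 * Real.sqrt (a * x ^ 2 + 4 * c * x + 4 * b) := by
  have hmul : a * (a * x ^ 2 + 4 * c * x + 4 * b)
      = (a * x + 2 * c) ^ 2 + 4 * (b * a - c ^ 2) := by ring
  have hQ : 0 < a * x ^ 2 + 4 * c * x + 4 * b := by
    refine pos_of_mul_pos_right (a := a) ?_ ha.le
    rw [hmul]
    nlinarith [sq_nonneg (a * x + 2 * c)]
  have hu : 0 < |1 - 3 * x| := abs_pos.2 fun h => hx (by linarith)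
  have hlt : |a * x + 2 * c| < Real.sqrt a * Real.sqrt (a * x ^ 2 + 4 * c * x + 4 * b) := by
    rw [← Real.sqrt_mul ha.le, hmul, ← Real.sqrt_sq_eq_abs]
    exact Real.sqrt_lt_sqrt (sq_nonneg _) (by linarith)
  have hcross : (1 - 3 * x) * (a * x + 2 * c) <
      |1 - 3 * x| * (Real.sqrt a * Real.sqrt (a * x ^ 2 + 4 * c * x + 4 * b)) :=
    calc (1 - 3 * x) * (a * x + 2 * c) ≤ |(1 - 3 * x) * (a * x + 2 * c)| := le_abs_self _
      _ = |1 - 3 * x| * |a * x + 2 * c| := abs_mul _ _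
      _ < _ := mul_lt_mul_of_pos_left hlt hu
  have hpos := Real.sqrt_pos.2 hQ
  rw [Real.sqrt_lt' (by positivity)]
  have hsq : (Real.sqrt a * |1 - 3 * x| + 3 * Real.sqrt (a * x ^ 2 + 4 * c * x + 4 * b)) ^ 2
      = a * (1 - 3 * x) ^ 2 + 9 * (a * x ^ 2 + 4 * c * x + 4 * b)
        + 6 * (|1 - 3 * x| * (Real.sqrt a * Real.sqrt (a * x ^ 2 + 4 * c * x + 4 * b))) := by
    rw [add_sq, mul_pow, mul_pow, Real.sq_sqrt ha.le, Real.sq_sqrt hQ.le, sq_abs]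
    ring
  rw [hsq]
  linarith

/-- The value at the kink `x = 1/3`. -/
lemma kink_value (a b c : ℝ) :
    Real.sqrt a * |1 - 3 * (1 / 3 : ℝ)|
        + 3 * Real.sqrt (a * (1 / 3) ^ 2 + 4 * c * (1 / 3) + 4 * b) =
      Real.sqrt (a + 12 * c + 36 * b) := by
  have h : a + 12 * c + 36 * b = 3 ^ 2 * (a * (1 / 3) ^ 2 + 4 * c * (1 / 3) + 4 * b) := by ring
  rw [h, Real.sqrt_mul (by norm_num), Real.sqrt_sq (by norm_num)]
  norm_num

/-- Minimisation of `f(x3) = √ε2·|1 − 3x3| + 3·√(ε2·x3² + 4·ε3·x3 + 4·ε0)` over `x3 ∈ ℝ`: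
if `ε0, ε2, ε3 > 0` and `ε0·ε2 > ε3²`, then `f(x3) ≥ √(ε2 + 12·ε3 + 36·ε0)` for all `x3`,
with equality if and only if `x3 = 1/3`. -/
theorem kink_coupling_minimisation (ε0 ε2 ε3 : ℝ)
    (h0 : 0 < ε0) (h2 : 0 < ε2) (h3 : 0 < ε3) (hdisc : ε3 ^ 2 < ε0 * ε2) :
    ∀ x3 : ℝ,
      Real.sqrt ε2 * |1 - 3 * x3|
          + 3 * Real.sqrt (ε2 * x3 ^ 2 + 4 * ε3 * x3 + 4 * ε0) ≥
        Real.sqrt (ε2 + 12 * ε3 + 36 * ε0) ∧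
      (Real.sqrt ε2 * |1 - 3 * x3|
          + 3 * Real.sqrt (ε2 * x3 ^ 2 + 4 * ε3 * x3 + 4 * ε0) =
        Real.sqrt (ε2 + 12 * ε3 + 36 * ε0) ↔ x3 = 1 / 3) := by
  intro x
  by_cases hx : x = 1 / 3
  · subst hx
    exact ⟨(kink_value ε2 ε0 ε3).ge, fun _ => rfl, fun _ => kink_value ε2 ε0 ε3⟩
  · have h := sqrt_lt_kink_of_ne h2 hdisc hx
    exact ⟨h.le, fun he => absurd he h.ne', fun he => absurd he hx⟩
end

section
/- Let ε0, ε1, ε2, ε3 be positive real numbers with ε0·ε2 > ε3². Let x1, x2, x3, x4 be real numbers with x1 > 0, x2 > 0, 4·x2 − x3² > 0, 1 − 2·x3 > 0, and (4·x2 − x3²)·(1 − 2·x3) − x4² > 0. Then (ε0 + x1·ε1 + x2·ε2 + x3·ε3)² · (1/x1) · ( 9 + (1 − 2·x3)·(1 − 3·x3)² / ((1 − 2·x3)·(4·x2 − x3²) − x4²) ) ≥ ε1·(ε2 + 12·ε3 + 36·ε0). -/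
/-- Lower bound on the squared Bogomol'nyi mass index (Proposition on optimal couplings):
for positive energy integrals `ε0, ε1, ε2, ε3` with `ε0·ε2 > ε3²` and admissible couplings
`(x1, x2, x3, x4)`, the quantity `(24π²·E_BMI)²` is bounded below by
`ε1·(ε2 + 12·ε3 + 36·ε0)`. -/
theorem BMI_squared_lower_bound (ε0 ε1 ε2 ε3 : ℝ)
    (h0 : 0 < ε0) (h1 : 0 < ε1) (h2 : 0 < ε2) (h3 : 0 < ε3)
    (hdisc : ε3 ^ 2 < ε0 * ε2)
    (x1 x2 x3 x4 : ℝ)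
    (hx1 : 0 < x1) (hx2 : 0 < x2)
    (ha : 0 < 4 * x2 - x3 ^ 2)
    (hb : 0 < 1 - 2 * x3)
    (hc : 0 < (4 * x2 - x3 ^ 2) * (1 - 2 * x3) - x4 ^ 2) :
    (ε0 + x1 * ε1 + x2 * ε2 + x3 * ε3) ^ 2 * (1 / x1)
        * (9 + (1 - 2 * x3) * (1 - 3 * x3) ^ 2
            / ((1 - 2 * x3) * (4 * x2 - x3 ^ 2) - x4 ^ 2)) ≥
      ε1 * (ε2 + 12 * ε3 + 36 * ε0) := by
  set a := 4 * x2 - x3 ^ 2 with ha_def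
  set S := ε0 + x2 * ε2 + x3 * ε3 with hS_def
  have hS : 0 < S := by
    have h : 0 < ε2 * (4 * S) := by
      have : ε2 * (4 * S) = a * ε2 ^ 2 + (2 * ε3 + x3 * ε2) ^ 2 + 4 * (ε0 * ε2 - ε3 ^ 2) := by
        rw [hS_def, ha_def]; ring
      rw [this]
      have := sub_pos.mpr hdisc
      positivity
    linarith [pos_of_mul_pos_right h h2.le]
  have hx4 : (1 - 3 * x3) ^ 2 / a ≤
      (1 - 2 * x3) * (1 - 3 * x3) ^ 2 / ((1 - 2 * x3) * a - x4 ^ 2) := by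
    rw [div_le_div_iff₀ ha (by linarith)]
    nlinarith [mul_nonneg (sq_nonneg (1 - 3 * x3)) (sq_nonneg x4)]
  have hamgm : 4 * ε1 * S ≤ (ε0 + x1 * ε1 + x2 * ε2 + x3 * ε3) ^ 2 * (1 / x1) := by
    rw [mul_one_div, le_div_iff₀ hx1]
    have : ε0 + x1 * ε1 + x2 * ε2 + x3 * ε3 = S + x1 * ε1 := by rw [hS_def]; ring
    rw [this]
    nlinarith [sq_nonneg (S - x1 * ε1)]
  have hopt : ε2 + 12 * ε3 + 36 * ε0 ≤ 4 * S * (9 + (1 - 3 * x3) ^ 2 / a) := by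
    have hfrac : 4 * S * (9 + (1 - 3 * x3) ^ 2 / a)
        = 4 * S * (9 * a + (1 - 3 * x3) ^ 2) / a := by
      field_simp
    rw [hfrac, le_div_iff₀ ha]
    refine le_of_mul_le_mul_left (sub_nonneg.mp ?_) h2
    have hsq : ε2 * (4 * S * (9 * a + (1 - 3 * x3) ^ 2))
          - ε2 * ((ε2 + 12 * ε3 + 36 * ε0) * a)
        = (3 * a * ε2 - (1 - 3 * x3) * (2 * ε3 + x3 * ε2)) ^ 2
          + 4 * (1 - 3 * x3) ^ 2 * (ε0 * ε2 - ε3 ^ 2) := by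
      rw [hS_def, ha_def]; ring
    rw [hsq]
    have := sub_pos.mpr hdisc
    positivity
  calc ε1 * (ε2 + 12 * ε3 + 36 * ε0)
      ≤ ε1 * (4 * S * (9 + (1 - 3 * x3) ^ 2 / a)) := by gcongr
    _ = 4 * ε1 * S * (9 + (1 - 3 * x3) ^ 2 / a) := by ring
    _ ≤ _ := by gcongr
end
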